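/- Let H be an infinite-dimensional complex Hilbert space. Then there exists a map φ: P(H) → P(H) with ‖φ(P) − φ(Q)‖ ≥ ‖P − Q‖ for all P, Q ∈ P(H) such that no linear or conjugate-linear isometry U: H → H satisfies φ(P) = UPU* for every P ∈ P(H). -/

import Mathlib

open scoped InnerProductSpace ComplexConjugate

variable {H : Type*} [NormedAddCommGroup H] [InnerProductSpace ℂ H] [CompleteSpace H]

/-- The rank-one (orthogonal) projection onto the span of a unit vector `v`,
i.e. `x ↦ ⟪v, x⟫ • v`. -/
noncomputable def rankOneProj (v : H) : H →L[ℂ] H :=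
  (innerSL ℂ v).smulRight v

/-- A rank-one projection: a self-adjoint idempotent bounded operator with
one-dimensional range. -/
def IsRankOneProjection (P : H →L[ℂ] H) : Prop :=
  IsSelfAdjoint P ∧ P ∘L P = P ∧ Module.finrank ℂ (LinearMap.range (P : H →ₗ[ℂ] H)) = 1

/-- A (not necessarily surjective) linear or conjugate-linear isometry `U : H → H`
implements `φ` if `φ(P) = U P U*` for every rank-one projection `P`; equivalently, `φ` sends
the projection onto `ℂv` to the projection onto `ℂ(Uv)` for every unit vector `v`. -/
def Implements (U : H → H)
    (φ : {P : H →L[ℂ] H // IsRankOneProjection P} → {P : H →L[ℂ] H // IsRankOneProjection P}) :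
    Prop :=
  (∀ x y, U (x + y) = U x + U y) ∧
  (∀ x, ‖U x‖ = ‖x‖) ∧
  ((∀ (c : ℂ) (x : H), U (c • x) = c • U x) ∨
    (∀ (c : ℂ) (x : H), U (c • x) = (starRingEnd ℂ) c • U x)) ∧
  (∀ (v : H), ‖v‖ = 1 → ∀ P : {P : H →L[ℂ] H // IsRankOneProjection P},
    P.1 = rankOneProj v → (φ P).1 = rankOneProj (U v))

omit [CompleteSpace H] in
theorem rankOneProj_apply (v x : H) : rankOneProj v x = ⟪v, x⟫_ℂ • v := by
  simp [rankOneProj]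

theorem isRankOneProjection_rankOneProj {v : H} (hv : ‖v‖ = 1) :
    IsRankOneProjection (rankOneProj v) := by
  refine ⟨?_, ?_, ?_⟩
  · rw [ContinuousLinearMap.isSelfAdjoint_iff_isSymmetric]
    intro x y
    simp [rankOneProj_apply, inner_smul_left, inner_smul_right, mul_comm]
  · ext x
    simp [rankOneProj_apply, hv]
  · have hrange : LinearMap.range (rankOneProj v : H →ₗ[ℂ] H) = ℂ ∙ v := by
      ext y
      rw [Submodule.mem_span_singleton]
      constructor
      · rintro ⟨x, rfl⟩
        exact ⟨⟪v, x⟫_ℂ, (rankOneProj_apply v x).symm⟩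
      · rintro ⟨c, rfl⟩
        exact ⟨c • v, by simp [rankOneProj_apply, hv]⟩
    rw [hrange]
    exact finrank_span_singleton (by rintro rfl; simp at hv)

/-- The distance between two orthogonal projections is at most one. -/
theorem norm_sub_le_one_of_isSelfAdjoint_of_idempotent {P Q : H →L[ℂ] H}
    (hP : IsSelfAdjoint P) (hP2 : P ∘L P = P) (hQ : IsSelfAdjoint Q) (hQ2 : Q ∘L Q = Q) :
    ‖P - Q‖ ≤ 1 := by
  refine ContinuousLinearMap.opNorm_le_bound _ zero_le_one fun x => ?_
  have key (A : H →L[ℂ] H) (hA : IsSelfAdjoint A) : ⟪A (A x), x⟫_ℂ = (‖A x‖ : ℂ) ^ 2 := by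
    have hs := (ContinuousLinearMap.isSelfAdjoint_iff_isSymmetric.1 hA) (A x) x
    exact hs.trans (inner_self_eq_norm_sq_to_K _)
  have hPx : P (P x) = P x := DFunLike.congr_fun hP2 x
  have hQx : Q (Q x) = Q x := DFunLike.congr_fun hQ2 x
  have hsum : (P - Q) ((P - Q) x) + (1 - P - Q) ((1 - P - Q) x) = x := by
    simp only [sub_apply, one_apply_eq_self, map_sub, hPx, hQx]
    abel
  have h1 := key (P - Q) (hP.sub hQ)
  have h2 := key (1 - P - Q) (((IsSelfAdjoint.one _).sub hP).sub hQ)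
  have h3 : ((‖(P - Q) x‖ : ℂ)) ^ 2 + (‖(1 - P - Q) x‖ : ℂ) ^ 2 = (‖x‖ : ℂ) ^ 2 := by
    rw [← h1, ← h2, ← inner_add_left, hsum]
    exact inner_self_eq_norm_sq_to_K _
  have h4 : ‖(P - Q) x‖ ^ 2 + ‖(1 - P - Q) x‖ ^ 2 = ‖x‖ ^ 2 := by exact_mod_cast h3
  rw [one_mul]
  exact le_of_sq_le_sq (by nlinarith [sq_nonneg ‖(1 - P - Q) x‖]) (norm_nonneg _)

/-- On an infinite-dimensional Hilbert space there is a linear isometry whose range is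
orthogonal to some unit vector. -/
theorem exists_linearIsometry_orthogonal_range (hinf : ¬ FiniteDimensional ℂ H) :
    ∃ (S : H →ₗᵢ[ℂ] H) (z : H), ‖z‖ = 1 ∧ ∀ x, ⟪z, S x⟫_ℂ = 0 := by
  obtain ⟨w, b, -⟩ := exists_hilbertBasis ℂ H
  have hw : Infinite w := by
    by_contra hfin
    rw [not_infinite_iff_finite] at hfin
    have := Fintype.ofFinite w
    exact hinf (Module.Basis.finiteDimensional_of_finite b.toOrthonormalBasis.toBasis)
  obtain ⟨e⟩ : Nonempty (Option w ≃ w) := by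
    rw [← Cardinal.eq, Cardinal.mk_option, Cardinal.add_one_eq (Cardinal.aleph0_le_mk w)]
  let f : w → w := fun j => e (some j)
  have hf : Function.Injective f := e.injective.comp (Option.some_injective w)
  have hV := (b.orthonormal.comp f hf).orthogonalFamily
  refine ⟨hV.linearIsometry.comp b.repr.toLinearIsometry, b (e none),
    b.orthonormal.1 _, fun x => ?_⟩
  have hs := (hV.hasSum_linearIsometry (b.repr x)).mapL (innerSL ℂ (b (e none)))
  refine hs.unique ?_
  convert hasSum_zero using 2 with j
  have hij : e none ≠ f j := by simp [f]
  simp [b.orthonormal.2 hij]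

theorem LinearIsometry.adjoint_apply_apply_self (S : H →ₗᵢ[ℂ] H) (x : H) :
    ContinuousLinearMap.adjoint S.toContinuousLinearMap (S x) = x :=
  DFunLike.congr_fun S.adjoint_comp_self x

theorem IsRankOneProjection.conj_linearIsometry {P : H →L[ℂ] H} (hP : IsRankOneProjection P)
    (S : H →ₗᵢ[ℂ] H) :
    IsRankOneProjection (S.toContinuousLinearMap ∘L P ∘L
      ContinuousLinearMap.adjoint S.toContinuousLinearMap) := by
  obtain ⟨hsa, hid, hrk⟩ := hP
  have hSS := S.adjoint_apply_apply_self
  refine ⟨hsa.conj_adjoint _, ?_, ?_⟩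
  · ext x
    simpa [hSS] using DFunLike.congr_fun hid _
  · have hrange : LinearMap.range ((S.toContinuousLinearMap ∘L P ∘L
        ContinuousLinearMap.adjoint S.toContinuousLinearMap : H →L[ℂ] H) : H →ₗ[ℂ] H) =
        (LinearMap.range (P : H →ₗ[ℂ] H)).map S.toLinearMap := by
      ext y
      constructor
      · rintro ⟨x, rfl⟩
        exact ⟨_, ⟨_, rfl⟩, rfl⟩
      · rintro ⟨_, ⟨x, rfl⟩, rfl⟩
        exact ⟨S x, by simp [hSS]⟩
    rw [hrange, ← hrk]
    exact (LinearEquiv.finrank_eq (Submodule.equivMapOfInjective _ S.injective _)).symm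

theorem norm_le_norm_conj_linearIsometry (A : H →L[ℂ] H) (S : H →ₗᵢ[ℂ] H) :
    ‖A‖ ≤ ‖S.toContinuousLinearMap ∘L A ∘L
      ContinuousLinearMap.adjoint S.toContinuousLinearMap‖ := by
  have hSS := S.adjoint_apply_apply_self
  refine ContinuousLinearMap.opNorm_le_bound _ (norm_nonneg _) fun x => ?_
  have h := (S.toContinuousLinearMap ∘L A ∘L
      ContinuousLinearMap.adjoint S.toContinuousLinearMap).le_opNorm (S x)
  simpa [hSS] using h

/-- Example 4.1. If `H` is infinite-dimensional, there is a
noncontractive map `φ` of the set of rank-one projections that is not implemented by any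
linear or conjugate-linear isometry `U : H → H`. -/
theorem exists_noncontractive_not_implemented
    (hinf : ¬ FiniteDimensional ℂ H) :
    ∃ φ : {P : H →L[ℂ] H // IsRankOneProjection P} → {P : H →L[ℂ] H // IsRankOneProjection P},
      (∀ P Q : {P : H →L[ℂ] H // IsRankOneProjection P},
        ‖(φ P).1 - (φ Q).1‖ ≥ ‖P.1 - Q.1‖) ∧
      ¬ ∃ U : H → H, Implements U φ := by
  classical
  obtain ⟨S, z, hz, hzS⟩ := exists_linearIsometry_orthogonal_range hinf
  have hzz : ⟪z, z⟫_ℂ = 1 := inner_self_eq_one_of_norm_eq_one hz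
  have hadj : ContinuousLinearMap.adjoint S.toContinuousLinearMap z = 0 := by
    refine ext_inner_right ℂ fun y => ?_
    rw [ContinuousLinearMap.adjoint_inner_left, inner_zero_left]
    exact hzS y
  let P₀ : {P : H →L[ℂ] H // IsRankOneProjection P} :=
    ⟨rankOneProj z, isRankOneProjection_rankOneProj hz⟩
  let ψ : {P : H →L[ℂ] H // IsRankOneProjection P} → {P : H →L[ℂ] H // IsRankOneProjection P} :=
    fun P => ⟨_, P.2.conj_linearIsometry S⟩
  have hfar (P : {P : H →L[ℂ] H // IsRankOneProjection P}) :
      ‖P₀.1 - P.1‖ ≤ ‖P₀.1 - (ψ P).1‖ := by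
    refine (norm_sub_le_one_of_isSelfAdjoint_of_idempotent P₀.2.1 P₀.2.2.1 P.2.1 P.2.2.1).trans ?_
    have h := (P₀.1 - (ψ P).1).le_opNorm z
    simpa [P₀, ψ, rankOneProj_apply, hzz, hadj, hz] using h
  refine ⟨fun P => if P = P₀ then P₀ else ψ P, fun P Q => ?_, ?_⟩
  · by_cases hP : P = P₀ <;> by_cases hQ : Q = P₀
    · simp [hP, hQ]
    · simpa [hP, hQ] using hfar Q
    · rw [norm_sub_rev, norm_sub_rev P.1]
      simpa [hP, hQ] using hfar P
    · simp only [hP, hQ, if_false]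
      have h := norm_le_norm_conj_linearIsometry (P.1 - Q.1) S
      simpa [ψ, ContinuousLinearMap.sub_comp, ContinuousLinearMap.comp_sub] using h
  · rintro ⟨U, hadd, hnorm, hsmul, himp⟩
    have hUU (v : H) (hv : ‖v‖ = 1) : ⟪U v, U v⟫_ℂ = 1 :=
      inner_self_eq_one_of_norm_eq_one ((hnorm v).trans hv)
    have hUz : ⟪z, U z⟫_ℂ ≠ 0 := by
      intro h0
      have h := DFunLike.congr_fun (himp z hz P₀ rfl) (U z)
      simp only [if_true, P₀, rankOneProj_apply, hUU z hz, h0, zero_smul, one_smul] at h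
      have h1 := hnorm z
      rw [← h, norm_zero, hz] at h1
      exact zero_ne_one h1
    have horth (v : H) (hv : ‖v‖ = 1) (hne : rankOneProj v ≠ rankOneProj z) :
        ⟪z, U v⟫_ℂ = 0 := by
      have hne' : (⟨rankOneProj v, isRankOneProjection_rankOneProj hv⟩ :
          {P : H →L[ℂ] H // IsRankOneProjection P}) ≠ P₀ := fun h => hne (congrArg Subtype.val h)
      have h := DFunLike.congr_fun (himp v hv ⟨_, isRankOneProjection_rankOneProj hv⟩ rfl) (U v)
      simp only [if_neg hne'] at h
      rw [rankOneProj_apply, hUU v hv, one_smul] at h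
      rw [← h]
      exact hzS _
    have hSz : ⟪S z, S z⟫_ℂ = 1 := by rw [S.inner_map_map, hzz]
    have hSz' : ⟪S z, z⟫_ℂ = 0 := by rw [← inner_conj_symm, hzS, map_zero]
    have hcomb (c : ℂ) (hc : c ≠ 0) (hcc : conj c * c = 16 / 25) :
        ⟪z, U ((3 / 5 : ℂ) • z + c • S z)⟫_ℂ = 0 := by
      refine horth _ ?_ fun h => ?_
      · have hin : ⟪(3 / 5 : ℂ) • z + c • S z, (3 / 5 : ℂ) • z + c • S z⟫_ℂ = 1 := by
          simp only [inner_add_left, inner_add_right, inner_smul_left, inner_smul_right, hzz, hSz,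
            hSz', hzS, map_div₀, map_ofNat]
          linear_combination hcc
        rw [inner_self_eq_norm_sq_to_K] at hin
        have hsq : ‖(3 / 5 : ℂ) • z + c • S z‖ ^ 2 = 1 := Complex.ofReal_injective (by simpa using hin)
        exact (pow_eq_one_iff_of_nonneg (norm_nonneg _) two_ne_zero).1 hsq
      · have h1 := congrArg (fun A : H →L[ℂ] H => ⟪S z, A z⟫_ℂ) h
        simp only [rankOneProj_apply, inner_add_left, inner_add_right, inner_smul_left,
          inner_smul_right, hzz, hSz, hSz'] at h1
        simp [hc] at h1
    have h1 := hcomb (4 / 5) (by norm_num) (by norm_num [map_ofNat])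
    have h2 := hcomb (-(4 / 5)) (by norm_num) (by norm_num [map_ofNat])
    have hsum : ((3 / 5 : ℂ) • z + (4 / 5 : ℂ) • S z) + ((3 / 5 : ℂ) • z + (-(4 / 5) : ℂ) • S z) =
        (6 / 5 : ℂ) • z := by module
    have h3 : ⟪z, U ((6 / 5 : ℂ) • z)⟫_ℂ = 0 := by
      rw [← hsum, hadd, inner_add_right, h1, h2, add_zero]
    rcases hsmul with h | h <;> rw [h, inner_smul_right] at h3 <;> simp [hUz] at h3
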